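/- There exist constants α, γ > 0 such that for every even n, every polyhedron K ⊆ ℝ^E with P_vjoin↑(n) ⊆ K ⊆ (1 − α/n⁴)·P_vjoin↑(n) satisfies xc(K) > 2^{γ·n}. -/

import Mathlib

open scoped ENNReal Pointwise

/-- The relative distance between two sets `A ⊆ B ⊆ ℝ^ι`:
`rdist(A,B) = sup_{π linear} d_H(π(A),π(B)) / diam(π(A))`, computed in `ℝ≥0∞`,
so that a fraction with `∞` in the denominator as well as `0/0` is `0`,
`rdist(∅,∅) = 0` and `rdist(∅,B) = ∞` for `B ≠ ∅`. -/
noncomputable def relDist {ι : Type*} (A B : Set (ι → ℝ)) : ℝ≥0∞ :=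
  ⨆ π : (ι → ℝ) →ₗ[ℝ] ℝ,
    (⨆ b ∈ B, ⨅ a ∈ A, ENNReal.ofReal |π b - π a|) /
      (⨆ a ∈ A, ⨆ a' ∈ A, ENNReal.ofReal |π a - π a'|)

/-- `Q` is a polyhedron given as the intersection of an affine subspace with at most `m`
closed halfspaces (`m` serving as the number of facets). -/
def IsPolyhedronOfSize {ι : Type*} (Q : Set (ι → ℝ)) (m : ℕ) : Prop :=
  ∃ (S : AffineSubspace ℝ (ι → ℝ)) (nh : ℕ), nh ≤ m ∧
    ∃ (f : Fin nh → ((ι → ℝ) →ₗ[ℝ] ℝ)) (b : Fin nh → ℝ),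
      Q = (S : Set (ι → ℝ)) ∩ {x | ∀ i, f i x ≤ b i}

/-- `Q` is a polyhedron. -/
def IsPolyhedron {ι : Type*} (Q : Set (ι → ℝ)) : Prop := ∃ m, IsPolyhedronOfSize Q m

/-- `P` admits a linear extended formulation of size at most `m`: `P = π(Q)` for a
polyhedron `Q` with at most `m` facets and an affine map `π`.  Thus `xc(P) ≤ m` iff
`ExtensionOfSizeLE P m`. -/
def ExtensionOfSizeLE {ι : Type*} (P : Set (ι → ℝ)) (m : ℕ) : Prop :=
  ∃ (l : ℕ) (Q : Set (Fin l → ℝ)) (π : (Fin l → ℝ) →ᵃ[ℝ] (ι → ℝ)),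
    IsPolyhedronOfSize Q m ∧ P = π '' Q

/-- The edge set of the complete undirected graph `K_n` on vertex set `Fin n`. -/
abbrev CompleteEdge (n : ℕ) := {e : Sym2 (Fin n) // ¬ e.IsDiag}

/-- `F` is a `V`-join in `K_n`: every vertex has odd degree in `(V, F)`. -/
def IsVJoin (n : ℕ) (F : Set (Sym2 (Fin n))) : Prop :=
  (∀ e ∈ F, ¬ e.IsDiag) ∧ ∀ v : Fin n, Odd {e ∈ F | v ∈ e}.ncard

/-- The `V`-join polytope of `K_n`: the convex hull in `ℝ^E` of the characteristic vectors
of all `V`-joins. -/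
noncomputable def vjoinPolytope (n : ℕ) : Set (CompleteEdge n → ℝ) :=
  convexHull ℝ { x | ∃ F : Set (Sym2 (Fin n)), IsVJoin n F ∧
    x = fun e : CompleteEdge n => Set.indicator F (fun _ => (1 : ℝ)) e.val }

/-- The dominant of the `V`-join polytope of `K_n`. -/
noncomputable def vjoinDominant (n : ℕ) : Set (CompleteEdge n → ℝ) :=
  vjoinPolytope n + {x | ∀ e, 0 ≤ x e}

/-- **Farkas' lemma** for finitely many linear functionals on a real vector space. -/
theorem farkas_dual {W : Type*} [AddCommGroup W] [Module ℝ W] :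
    ∀ (n : ℕ) (F : Fin n → W →ₗ[ℝ] ℝ) (G : W →ₗ[ℝ] ℝ),
      (∀ w, (∀ i, 0 ≤ F i w) → 0 ≤ G w) →
      ∃ c : Fin n → ℝ, (∀ i, 0 ≤ c i) ∧ ∀ w, G w = ∑ i, c i * F i w := by
  intro n
  induction n with
  | zero =>
    intro F G h
    refine ⟨fun _ => 0, fun _ => le_rfl, fun w => ?_⟩
    have h1 := h w (fun i => i.elim0)
    have h2 := h (-w) (fun i => i.elim0)
    rw [map_neg] at h2
    simp only [Finset.univ_eq_empty, Finset.sum_empty]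
    linarith
  | succ n ih =>
    intro F G h
    by_cases h0 : ∀ w, (∀ i : Fin n, 0 ≤ F i.castSucc w) → 0 ≤ G w
    · obtain ⟨c, hc, hG⟩ := ih (fun i => F i.castSucc) G h0
      refine ⟨Fin.snoc c 0, fun i => ?_, fun w => ?_⟩
      · refine Fin.lastCases ?_ (fun i => ?_) i
        · simp
        · simpa using hc i
      · rw [Fin.sum_univ_castSucc]
        simp [hG w]
    · push Not at h0
      obtain ⟨w1, hw1, hG1⟩ := h0
      have hlast : F (Fin.last n) w1 < 0 := by
        by_contra hcon
        push Not at hcon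
        refine absurd (h w1 fun i => ?_) (not_le.mpr hG1)
        exact Fin.lastCases hcon hw1 i
      set s : ℝ := -(F (Fin.last n) w1) with hs
      have hspos : 0 < s := by linarith
      set w0 : W := s⁻¹ • w1 with hw0
      have hF0 : ∀ i : Fin n, 0 ≤ F i.castSucc w0 := fun i => by
        rw [hw0, map_smul, smul_eq_mul]
        exact mul_nonneg (inv_nonneg.mpr hspos.le) (hw1 i)
      have hL0 : F (Fin.last n) w0 = -1 := by
        rw [hw0, map_smul, smul_eq_mul]
        field_simp
        linarith
      have hG0 : G w0 ≤ 0 := by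
        rw [hw0, map_smul, smul_eq_mul]
        exact mul_nonpos_of_nonneg_of_nonpos (inv_nonneg.mpr hspos.le) hG1.le
      obtain ⟨c, hc, hG⟩ := ih (fun i => F i.castSucc + (F i.castSucc w0) • F (Fin.last n))
        (G + (G w0) • F (Fin.last n)) (fun w hw => by
          have := h (w + F (Fin.last n) w • w0) (fun i => by
            refine Fin.lastCases ?_ (fun i => ?_) i
            · simp [hL0]
            · have := hw i
              simp only [LinearMap.add_apply, LinearMap.smul_apply, smul_eq_mul] at this
              simp only [map_add, map_smul, smul_eq_mul]
              linarith)
          simp only [map_add, map_smul, smul_eq_mul] at this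
          simp only [LinearMap.add_apply, LinearMap.smul_apply, smul_eq_mul]
          linarith)
      refine ⟨Fin.snoc c (∑ i, c i * F i.castSucc w0 - G w0), fun i => ?_, fun w => ?_⟩
      · refine Fin.lastCases ?_ (fun i => ?_) i
        · rw [Fin.snoc_last]
          have : 0 ≤ ∑ i, c i * F i.castSucc w0 :=
            Finset.sum_nonneg fun i _ => mul_nonneg (hc i) (hF0 i)
          linarith
        · simpa using hc i
      · have := hG w
        simp only [LinearMap.add_apply, LinearMap.smul_apply, smul_eq_mul, mul_add,
          Finset.sum_add_distrib] at this
        rw [Fin.sum_univ_castSucc]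
        simp only [Fin.snoc_castSucc, Fin.snoc_last]
        have h2 : (∑ i, c i * F i.castSucc w0) * F (Fin.last n) w
            = ∑ i, c i * (F i.castSucc w0 * F (Fin.last n) w) := by
          rw [Finset.sum_mul]
          exact Finset.sum_congr rfl fun i _ => by ring
        rw [sub_mul, h2]
        linarith

/-- Affine form of Farkas' lemma: a linear functional bounded below on a nonempty polyhedron is a
nonnegative combination of the slacks of the defining inequalities plus a nonnegative constant. -/
theorem farkas_affine {W : Type*} [AddCommGroup W] [Module ℝ W] (S : AffineSubspace ℝ W) {n : ℕ}
    (f : Fin n → W →ₗ[ℝ] ℝ) (b : Fin n → ℝ) {q₀ : W} (hq₀ : q₀ ∈ S) (hfq₀ : ∀ i, f i q₀ ≤ b i)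
    (L : W →ₗ[ℝ] ℝ) (δ : ℝ) (hL : ∀ q ∈ S, (∀ i, f i q ≤ b i) → δ ≤ L q) :
    ∃ c : Fin (n + 1) → ℝ, (∀ i, 0 ≤ c i) ∧
      ∀ q ∈ S, L q - δ = ∑ i : Fin n, c i.castSucc * (b i - f i q) + c (Fin.last n) := by
  let sub := S.direction.subtype
  let fs : S.direction × ℝ →ₗ[ℝ] W := sub ∘ₗ LinearMap.fst ℝ S.direction ℝ
  let sn : S.direction × ℝ →ₗ[ℝ] ℝ := LinearMap.snd ℝ S.direction ℝ
  let F : Fin (n + 1) → (S.direction × ℝ →ₗ[ℝ] ℝ) :=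
    Fin.snoc (fun i : Fin n => (b i - f i q₀) • sn - (f i) ∘ₗ fs) sn
  let G : S.direction × ℝ →ₗ[ℝ] ℝ := (L q₀ - δ) • sn + L ∘ₗ fs
  have hFc : ∀ (i : Fin n) (d : S.direction) (t : ℝ),
      F i.castSucc (d, t) = (b i - f i q₀) * t - f i (d : W) := fun i d t => by
    simp [F, fs, sn, sub]
  have hFl : ∀ (d : S.direction) (t : ℝ), F (Fin.last n) (d, t) = t := fun d t => by
    simp [F, sn]
  have hGv : ∀ (d : S.direction) (t : ℝ), G (d, t) = (L q₀ - δ) * t + L (d : W) := fun d t => by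
    simp [G, fs, sn, sub]
  have hmem : ∀ (d : S.direction) (r : ℝ), q₀ + r • (d : W) ∈ S := fun d r => by
    rw [add_comm]
    exact AffineSubspace.vadd_mem_of_mem_direction (S.direction.smul_mem r d.2) hq₀
  obtain ⟨c, hc, hG⟩ := farkas_dual (n + 1) F G (by
    rintro ⟨d, t⟩ hw
    have ht : 0 ≤ t := by simpa [hFl] using hw (Fin.last n)
    have hi : ∀ i : Fin n, f i (d : W) ≤ (b i - f i q₀) * t := fun i => by
      have := hw i.castSucc
      rw [hFc] at this
      linarith
    rw [hGv]
    rcases ht.eq_or_lt with ht0 | htpos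
    · subst ht0
      simp only [mul_zero] at hi ⊢
      by_contra hneg
      push Not at hneg
      rw [zero_add] at hneg
      set r : ℝ := (L q₀ - δ + 1) / (-(L (d : W))) with hr
      have hLq : δ ≤ L q₀ := hL q₀ hq₀ hfq₀
      have hr0 : 0 ≤ r := div_nonneg (by linarith) (by linarith)
      have := hL _ (hmem d r) (fun i => by
        rw [map_add, map_smul, smul_eq_mul]
        have := mul_nonneg hr0 (neg_nonneg.mpr (hi i))
        linarith [hfq₀ i])
      rw [map_add, map_smul, smul_eq_mul] at this
      have h3 : r * L (d : W) = -(L q₀ - δ + 1) := by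
        rw [hr]
        have : L (d : W) ≠ 0 := hneg.ne
        field_simp
      linarith
    · have h1 := hL _ (hmem d t⁻¹) (fun i => by
        rw [map_add, map_smul, smul_eq_mul]
        have h2 := mul_le_mul_of_nonneg_left (hi i) (inv_nonneg.mpr ht)
        have h3 : t⁻¹ * ((b i - f i q₀) * t) = b i - f i q₀ := by field_simp
        linarith)
      rw [map_add, map_smul, smul_eq_mul] at h1
      have h2 := mul_le_mul_of_nonneg_right h1 ht
      have h3 : (L q₀ + t⁻¹ * L (d : W)) * t = L q₀ * t + L (d : W) := by field_simp
      linarith)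
  refine ⟨c, hc, fun q hq => ?_⟩
  have hd : q - q₀ ∈ S.direction := AffineSubspace.vsub_mem_direction hq hq₀
  have h1 := hG (⟨q - q₀, hd⟩, 1)
  rw [hGv, Fin.sum_univ_castSucc, hFl] at h1
  simp only [hFc, map_sub, mul_one] at h1
  have h2 : ∀ i, c (Fin.castSucc i) * (b i - (f i) q₀ - ((f i) q - (f i) q₀))
      = c (Fin.castSucc i) * (b i - f i q) := fun i => by ring
  simp only [h2] at h1
  linarith

/-- The sum of `φ` over the subcube `x i = b`. -/
def subcubeSum {D : Type*} [Fintype D] [DecidableEq D] (φ : (D → Bool) → ℝ) (i : D)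
    (b : Bool) : ℝ :=
  ∑ x, if x i = b then φ x else 0

section Cube

variable {D : Type*} [Fintype D] [DecidableEq D]

theorem subcubeSum_add (φ : (D → Bool) → ℝ) (i : D) :
    subcubeSum φ i false + subcubeSum φ i true = ∑ x, φ x := by
  unfold subcubeSum
  rw [← Finset.sum_add_distrib]
  refine Finset.sum_congr rfl fun x _ => ?_
  cases x i <;> simp

theorem subcubeSum_nonneg {φ : (D → Bool) → ℝ} (h0 : ∀ x, 0 ≤ φ x) (i : D) (b : Bool) :
    0 ≤ subcubeSum φ i b :=
  Finset.sum_nonneg fun x _ => by split_ifs; exacts [h0 x, le_rfl]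

theorem subcubeSum_le {φ : (D → Bool) → ℝ} (h0 : ∀ x, 0 ≤ φ x) (i : D) (b : Bool) :
    subcubeSum φ i b ≤ ∑ x, φ x :=
  Finset.sum_le_sum fun x _ => by split_ifs; exacts [le_rfl, h0 x]

theorem sum_cube_le {φ : (D → Bool) → ℝ} {F : ℝ} (hF : ∀ x, φ x ≤ F) :
    ∑ x, φ x ≤ F * 2 ^ Fintype.card D := by
  refine (Finset.sum_le_sum fun x _ => hF x).trans ?_
  simp [mul_comm]

/-- If a nonnegative function on the cube is biased in every coordinate of `B`, its total mass is
exponentially small in `#B`. -/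
theorem sum_le_of_biased {φ : (D → Bool) → ℝ} {F c : ℝ} (h0 : ∀ x, 0 ≤ φ x) (hF : ∀ x, φ x ≤ F)
    (hc : 0 ≤ c) (B : Finset D)
    (hB : ∀ i ∈ B, c * ∑ x, φ x ≤ |subcubeSum φ i false - subcubeSum φ i true|) :
    ∑ x, φ x ≤ F * 2 ^ Fintype.card D * Real.exp (-(c ^ 2 * B.card / 2)) := by
  set p := ∑ x, φ x with hp
  let s : D → ℝ := fun i => if 0 ≤ subcubeSum φ i false - subcubeSum φ i true then 1 else -1
  let χ : Bool → ℝ := fun b => if b then -1 else 1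
  let Y : (D → Bool) → ℝ := fun x => ∑ i ∈ B, s i * χ (x i)
  have hs : ∀ i, s i * (subcubeSum φ i false - subcubeSum φ i true)
      = |subcubeSum φ i false - subcubeSum φ i true| := fun i => by
    by_cases h : 0 ≤ subcubeSum φ i false - subcubeSum φ i true
    · simp only [s, if_pos h, one_mul, abs_of_nonneg h]
    · simp only [s, if_neg h, abs_of_neg (not_le.mp h)]
      ring
  have hχ : ∀ i, ∑ x, φ x * χ (x i) = subcubeSum φ i false - subcubeSum φ i true := fun i => by
    unfold subcubeSum
    rw [← Finset.sum_sub_distrib]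
    refine Finset.sum_congr rfl fun x _ => ?_
    cases h : x i <;> simp [χ]
  have hY : c * p * B.card ≤ ∑ x, φ x * Y x := by
    have h1 : ∑ x, φ x * Y x = ∑ i ∈ B, s i * ∑ x, φ x * χ (x i) := by
      simp only [Y, Finset.mul_sum]
      rw [Finset.sum_comm]
      exact Finset.sum_congr rfl fun i _ => Finset.sum_congr rfl fun x _ => by ring
    rw [h1]
    have h2 : ∑ i ∈ B, c * p ≤ ∑ i ∈ B, s i * ∑ x, φ x * χ (x i) :=
      Finset.sum_le_sum fun i hi => by rw [hχ, hs]; exact hB i hi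
    simpa [mul_comm, mul_left_comm] using h2
  have hexp : ∑ x, Real.exp (c * Y x) ≤ 2 ^ Fintype.card D * Real.exp (c ^ 2 * B.card / 2) := by
    have h1 : ∀ x : D → Bool, Real.exp (c * Y x)
        = ∏ i, (if i ∈ B then Real.exp (c * (s i * χ (x i))) else 1) := fun x => by
      rw [Finset.prod_ite_mem, Finset.univ_inter, ← Real.exp_sum]
      simp only [Y, Finset.mul_sum]
    have h2 : ∀ i, ∑ b : Bool, (if i ∈ B then Real.exp (c * (s i * χ b)) else 1)
        ≤ 2 * (if i ∈ B then Real.exp (c ^ 2 / 2) else 1) := fun i => by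
      by_cases hi : i ∈ B
      · simp only [if_pos hi, Fintype.sum_bool]
        have h3 := Real.cosh_le_exp_half_sq c
        rw [Real.cosh_eq] at h3
        by_cases h : 0 ≤ subcubeSum φ i false - subcubeSum φ i true
        · simp only [s, if_pos h, χ]
          norm_num
          linarith
        · simp only [s, if_neg h, χ]
          norm_num
          linarith
      · simp only [if_neg hi]
        norm_num
    calc ∑ x, Real.exp (c * Y x)
        = ∑ x : D → Bool, ∏ i, (if i ∈ B then Real.exp (c * (s i * χ (x i))) else 1) :=
          Finset.sum_congr rfl fun x _ => h1 x
      _ = ∏ i, ∑ b : Bool, (if i ∈ B then Real.exp (c * (s i * χ b)) else 1) := by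
          rw [Finset.prod_univ_sum, Fintype.piFinset_univ]
      _ ≤ ∏ i, 2 * (if i ∈ B then Real.exp (c ^ 2 / 2) else 1) :=
          Finset.prod_le_prod (fun i _ => Finset.sum_nonneg fun b _ => by
            split_ifs <;> positivity) fun i _ => h2 i
      _ = 2 ^ Fintype.card D * Real.exp (c ^ 2 * B.card / 2) := by
          rw [Finset.prod_mul_distrib, Finset.prod_ite_mem, Finset.univ_inter, Finset.prod_const,
            Finset.prod_const, ← Real.exp_nat_mul, Finset.card_univ]
          congr 2
          ring
  set y := c ^ 2 * (B.card : ℝ) with hy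
  have hlow : Real.exp y * p ≤ ∑ x, φ x * Real.exp (c * Y x) := by
    have h1 : ∀ x, Real.exp y * (φ x * (1 + c * Y x - y)) ≤ φ x * Real.exp (c * Y x) := fun x => by
      have h2 := Real.add_one_le_exp (c * Y x - y)
      have h3 : Real.exp (c * Y x) = Real.exp y * Real.exp (c * Y x - y) := by
        rw [← Real.exp_add]; congr 1; ring
      rw [h3]
      have h4 := mul_le_mul_of_nonneg_left h2 (mul_nonneg (Real.exp_pos y).le (h0 x))
      linarith
    have h5 : ∑ x, Real.exp y * (φ x * (1 + c * Y x - y))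
        = Real.exp y * (p + c * ∑ x, φ x * Y x - y * p) := by
      rw [← Finset.mul_sum, hp]
      congr 1
      rw [Finset.mul_sum, Finset.mul_sum, ← Finset.sum_add_distrib, ← Finset.sum_sub_distrib]
      exact Finset.sum_congr rfl fun x _ => by ring
    refine le_trans ?_ (Finset.sum_le_sum fun x _ => h1 x)
    rw [h5]
    refine mul_le_mul_of_nonneg_left ?_ (Real.exp_pos y).le
    have h6 := mul_le_mul_of_nonneg_left hY hc
    have h7 : c * (c * p * B.card) = y * p := by rw [hy]; ring
    linarith
  have hF0 : 0 ≤ F := (h0 fun _ => false).trans (hF _)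
  have hup : ∑ x, φ x * Real.exp (c * Y x)
      ≤ F * (2 ^ Fintype.card D * Real.exp (y / 2)) := by
    refine le_trans ?_ (mul_le_mul_of_nonneg_left hexp hF0)
    rw [Finset.mul_sum]
    exact Finset.sum_le_sum fun x _ => mul_le_mul_of_nonneg_right (hF x) (Real.exp_pos _).le
  have h8 : p = Real.exp (-y) * (Real.exp y * p) := by
    rw [← mul_assoc, ← Real.exp_add]; simp
  rw [h8]
  refine (mul_le_mul_of_nonneg_left (hlow.trans hup) (Real.exp_pos _).le).trans (le_of_eq ?_)
  have h9 : Real.exp (-(y / 2)) = Real.exp (-y) * Real.exp (y / 2) := by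
    rw [← Real.exp_add]; congr 1; ring
  rw [h9]
  ring

/-- The relation between the masses of two opposite subcubes which fails on the biased
coordinates. -/
def IsBalanced (p q : ℝ) : Prop := |p - q| ≤ 1 / 50 * (p + q)

open Classical in
/-- Unless `φ` has exponentially small mass, only few coordinates are unbalanced. -/
theorem sum_unbalanced_le {φ : (D → Bool) → ℝ} {F : ℝ} (h0 : ∀ x, 0 ≤ φ x) (hF : ∀ x, φ x ≤ F) :
    ∑ i, (if IsBalanced (subcubeSum φ i false) (subcubeSum φ i true) then 0
        else subcubeSum φ i false)
      ≤ 1 / 40 * ∑ i, subcubeSum φ i false + Fintype.card D *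
        (F * 2 ^ Fintype.card D * Real.exp (-(Fintype.card D / 800000))) := by
  set p := ∑ x, φ x with hp
  have hp0 : 0 ≤ p := Finset.sum_nonneg fun x _ => h0 x
  have hF0 : 0 ≤ F := (h0 fun _ => false).trans (hF _)
  set N : ℝ := (Fintype.card D : ℝ) with hN
  have hN0 : 0 ≤ N := Nat.cast_nonneg _
  let B : Finset D := Finset.univ.filter fun i =>
    ¬ IsBalanced (subcubeSum φ i false) (subcubeSum φ i true)
  have hsum : ∑ i, (if IsBalanced (subcubeSum φ i false) (subcubeSum φ i true) then 0
        else subcubeSum φ i false) = ∑ i ∈ B, subcubeSum φ i false := by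
    rw [Finset.sum_filter]
    exact Finset.sum_congr rfl fun i _ => by split_ifs <;> rfl
  rw [hsum]
  have hBle : ∑ i ∈ B, subcubeSum φ i false ≤ B.card * p := by
    refine (Finset.sum_le_sum fun i _ => subcubeSum_le h0 i false).trans (le_of_eq ?_)
    simp [hp]
  by_cases hcard : (B.card : ℝ) ≤ N / 160
  · have hcompl : (Bᶜ.card : ℝ) = N - B.card := by
      rw [Finset.card_compl, Nat.cast_sub (Finset.card_le_univ B)]
    have hlow : (Bᶜ.card : ℝ) * (49 / 100 * p) ≤ ∑ i, subcubeSum φ i false := by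
      have h1 : ∑ i ∈ Bᶜ, (49 / 100 * p) ≤ ∑ i ∈ Bᶜ, subcubeSum φ i false :=
        Finset.sum_le_sum fun i hi => by
          have h2 : IsBalanced (subcubeSum φ i false) (subcubeSum φ i true) := by
            simpa [B] using hi
          unfold IsBalanced at h2
          have h3 := subcubeSum_add φ i
          have h4 := (abs_le.mp h2).1
          linarith
      have h5 : ∑ i ∈ Bᶜ, subcubeSum φ i false ≤ ∑ i, subcubeSum φ i false :=
        Finset.sum_le_sum_of_subset_of_nonneg (Finset.subset_univ _)
          fun i _ _ => subcubeSum_nonneg h0 i false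
      rw [Finset.sum_const, nsmul_eq_mul] at h1
      exact h1.trans h5
    have h6 : 0 ≤ N * (F * 2 ^ Fintype.card D * Real.exp (-(N / 800000))) := by positivity
    rw [hcompl] at hlow
    have h7 := mul_le_mul_of_nonneg_right hcard hp0
    have h8 : 0 ≤ N * p := mul_nonneg hN0 hp0
    nlinarith
  · push Not at hcard
    have h1 := sum_le_of_biased (c := 1 / 50) h0 hF (by norm_num) B (fun i hi => by
      have h2 : ¬ IsBalanced (subcubeSum φ i false) (subcubeSum φ i true) := by
        simpa [B] using hi
      unfold IsBalanced at h2
      rw [← subcubeSum_add φ i]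
      exact (not_le.mp h2).le)
    have h3 : Real.exp (-((1 / 50) ^ 2 * B.card / 2)) ≤ Real.exp (-(N / 800000)) :=
      Real.exp_le_exp.mpr (by linarith)
    have h4 : p ≤ F * 2 ^ Fintype.card D * Real.exp (-(N / 800000)) :=
      h1.trans (mul_le_mul_of_nonneg_left h3 (by positivity))
    have h5 : (B.card : ℝ) ≤ N := by rw [hN]; exact_mod_cast Finset.card_le_univ B
    have h6 : 0 ≤ ∑ i, subcubeSum φ i false :=
      Finset.sum_nonneg fun i _ => subcubeSum_nonneg h0 i false
    have h7 : (B.card : ℝ) * p ≤ N * (F * 2 ^ Fintype.card D * Real.exp (-(N / 800000))) :=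
      mul_le_mul h5 h4 hp0 hN0
    linarith

end Cube

section Averaging

variable {D Ω : Type*} [Fintype D] [DecidableEq D] [Fintype Ω]

open Classical in
/-- If the coordinate `d` plays the same role as every other coordinate up to a symmetry of `Ω`,
then on average over `Ω` the coordinate `d` is rarely unbalanced. -/
theorem sum_unbalanced_mul_le (d : D) (e : D → Equiv.Perm Ω) (φ : Ω → (D → Bool) → ℝ)
    (w : Ω → ℝ) {F W : ℝ} (h0 : ∀ σ x, 0 ≤ φ σ x) (hF : ∀ σ x, φ σ x ≤ F) (hw0 : ∀ σ, 0 ≤ w σ)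
    (hW : ∀ σ, w σ ≤ W) (hF0 : 0 ≤ F) (hwe : ∀ o σ, w (e o σ) = w σ)
    (hφe : ∀ o σ b, subcubeSum (φ (e o σ)) d b = subcubeSum (φ σ) o b) :
    ∑ σ, (if IsBalanced (subcubeSum (φ σ) d false) (subcubeSum (φ σ) d true) then 0
        else subcubeSum (φ σ) d false) * w σ
      ≤ 1 / 40 * ∑ σ, subcubeSum (φ σ) d false * w σ + Fintype.card Ω *
        (W * (F * 2 ^ Fintype.card D * Real.exp (-(Fintype.card D / 800000)))) := by
  set N : ℝ := (Fintype.card D : ℝ) with hN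
  have hNpos : 0 < N := by
    rw [hN]; exact_mod_cast Fintype.card_pos_iff.mpr ⟨d⟩
  set K : ℝ := F * 2 ^ Fintype.card D * Real.exp (-(N / 800000)) with hK
  have hK0 : 0 ≤ K := by positivity
  have key : ∀ h : ℝ → ℝ → ℝ,
      N * ∑ σ, h (subcubeSum (φ σ) d false) (subcubeSum (φ σ) d true) * w σ
        = ∑ σ, (∑ o, h (subcubeSum (φ σ) o false) (subcubeSum (φ σ) o true)) * w σ := fun h => by
    have h1 : ∀ o, ∑ σ, h (subcubeSum (φ σ) d false) (subcubeSum (φ σ) d true) * w σ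
        = ∑ σ, h (subcubeSum (φ σ) o false) (subcubeSum (φ σ) o true) * w σ := fun o => by
      rw [← Equiv.sum_comp (e o)]
      exact Finset.sum_congr rfl fun σ _ => by rw [hφe, hφe, hwe]
    calc N * ∑ σ, h (subcubeSum (φ σ) d false) (subcubeSum (φ σ) d true) * w σ
        = ∑ o : D, ∑ σ, h (subcubeSum (φ σ) d false) (subcubeSum (φ σ) d true) * w σ := by
          rw [Finset.sum_const, nsmul_eq_mul, Finset.card_univ]
      _ = ∑ o : D, ∑ σ, h (subcubeSum (φ σ) o false) (subcubeSum (φ σ) o true) * w σ :=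
          Finset.sum_congr rfl fun o _ => h1 o
      _ = _ := by
          rw [Finset.sum_comm]
          exact Finset.sum_congr rfl fun σ _ => by rw [Finset.sum_mul]
  have hbad := key fun p q => if IsBalanced p q then 0 else p
  have hall := key fun p _ => p
  have hmain : ∑ σ, (∑ o, if IsBalanced (subcubeSum (φ σ) o false) (subcubeSum (φ σ) o true) then 0
        else subcubeSum (φ σ) o false) * w σ
      ≤ ∑ σ, (1 / 40 * ((∑ o, subcubeSum (φ σ) o false) * w σ) + N * (W * K)) :=
    Finset.sum_le_sum fun σ _ => by
      have h1 := mul_le_mul_of_nonneg_right (sum_unbalanced_le (h0 σ) (hF σ)) (hw0 σ)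
      have h2 := mul_le_mul_of_nonneg_right (hW σ) (mul_nonneg hNpos.le hK0)
      simp only [← hN, ← hK] at h1
      linarith
  rw [Finset.sum_add_distrib, ← Finset.mul_sum, ← hall, ← hbad, Finset.sum_const, nsmul_eq_mul,
    Finset.card_univ] at hmain
  refine le_of_mul_le_mul_left ?_ hNpos
  linarith

end Averaging

theorem card_le_two_of_no_step : ∀ G : Finset (Fin 5), (∀ j ∈ G, j + 2 ∉ G) → G.card ≤ 2 := by
  decide

open Classical in
/-- The pentagon inequality: at most two of five balanced indices are pairwise nonadjacent. -/
theorem pentagon_inequality (u v : Fin 5 → ℝ) (s t : ℝ) (hu : ∀ j, 0 ≤ u j) (hv : ∀ j, 0 ≤ v j)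
    (hs : 0 ≤ s) (ht : 0 ≤ t) :
    ∑ j, u j * v j ≤ ∑ j, (if IsBalanced (u j) s then 0 else u j) * v j
      + ∑ j, (if IsBalanced (v j) t then 0 else v j) * u j + 13 / 6 * (s * t)
      + 6 * ∑ j, u j * v (j + 2) := by
  let G : Finset (Fin 5) := Finset.univ.filter fun j => IsBalanced (u j) s ∧ IsBalanced (v j) t
  have hG : ∀ j ∈ G, IsBalanced (u j) s ∧ IsBalanced (v j) t := fun j hj => by simpa [G] using hj
  have hup : ∀ {p q : ℝ}, IsBalanced p q → p ≤ 51 / 49 * q := fun {p q} h => by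
    have := (abs_le.mp h).2
    linarith
  have hlo : ∀ {p q : ℝ}, IsBalanced p q → q ≤ 51 / 49 * p := fun {p q} h => by
    have := (abs_le.mp h).1
    linarith
  have hst : 0 ≤ s * t := mul_nonneg hs ht
  have hsplit : ∑ j, u j * v j ≤ ∑ j, (if IsBalanced (u j) s then 0 else u j) * v j
      + ∑ j, (if IsBalanced (v j) t then 0 else v j) * u j + ∑ j ∈ G, u j * v j := by
    rw [Finset.sum_filter, ← Finset.sum_add_distrib, ← Finset.sum_add_distrib]
    refine Finset.sum_le_sum fun j _ => ?_
    have := mul_nonneg (hu j) (hv j)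
    by_cases h1 : IsBalanced (u j) s <;> by_cases h2 : IsBalanced (v j) t <;>
      simp [h1, h2] <;> linarith
  have hgood : ∑ j ∈ G, u j * v j ≤ G.card * ((51 / 49) ^ 2 * (s * t)) := by
    rw [← nsmul_eq_mul, ← Finset.sum_const]
    refine Finset.sum_le_sum fun j hj => ?_
    have := mul_le_mul (hup (hG j hj).1) (hup (hG j hj).2) (hv j) (by positivity)
    linarith
  have hadj : 0 ≤ ∑ j, u j * v (j + 2) := Finset.sum_nonneg fun j _ => mul_nonneg (hu _) (hv _)
  by_cases hind : ∀ j ∈ G, j + 2 ∉ G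
  · have hc : (G.card : ℝ) ≤ 2 := by exact_mod_cast card_le_two_of_no_step G hind
    have := mul_le_mul_of_nonneg_right hc (by positivity : 0 ≤ (51 / 49) ^ 2 * (s * t))
    linarith
  · push Not at hind
    obtain ⟨j, hj, hj2⟩ := hind
    have h1 : s * t ≤ (51 / 49) ^ 2 * (u j * v (j + 2)) := by
      have := mul_le_mul (hlo (hG j hj).1) (hlo (hG _ hj2).2) ht
        (mul_nonneg (by norm_num) (hu j))
      linarith
    have h2 : u j * v (j + 2) ≤ ∑ j, u j * v (j + 2) :=
      Finset.single_le_sum (f := fun j => u j * v (j + 2))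
        (fun j _ => mul_nonneg (hu _) (hv _)) (Finset.mem_univ j)
    have hc : (G.card : ℝ) ≤ 5 := by
      exact_mod_cast (Finset.card_le_univ G).trans (by simp)
    have h3 := mul_le_mul_of_nonneg_right hc (by positivity : 0 ≤ (51 / 49) ^ 2 * (s * t))
    linarith

/-- The vertices of the template: `m` blocks of two vertices, `m` blocks of four vertices, a
ladder with five rungs, and `r` additional pairs. -/
abbrev Template (m r : ℕ) : Type :=
  (Fin m × Bool) ⊕ (Fin m × Bool × Bool) ⊕ (Fin 5 × Bool) ⊕ (Fin r × Bool)

namespace Template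

instance (m r : ℕ) : DecidableEq (Template m r) := inferInstance

instance (m r : ℕ) : Fintype (Template m r) := inferInstance

variable {m r : ℕ}

/-- The cut determined by a pair `{j, j + 1}` of rungs and the bits `x`. -/
def cut (j : Fin 5) (x : Option (Fin m) → Bool) : Template m r → Bool
  | .inl (i, _) => x (some i)
  | .inr (.inl _) => false
  | .inr (.inr (.inl (l, s))) => !s && (if l = j ∨ l = j + 1 then x none else true)
  | .inr (.inr (.inr _)) => false

/-- The perfect matching determined by a pair `{j, j + 1}` of rungs and the bits `y`. -/
def mate (j : Fin 5) (y : Option (Fin m) → Bool) : Template m r → Template m r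
  | .inl (i, s) => .inl (i, !s)
  | .inr (.inl (i, s, t)) =>
    if y (some i) = true then .inr (.inl (i, !s, t)) else .inr (.inl (i, s, !t))
  | .inr (.inr (.inl (l, s))) =>
    if y none = true then .inr (.inr (.inl (l, !s)))
    else if l = j then .inr (.inr (.inl (j + 1, s)))
    else if l = j + 1 then .inr (.inr (.inl (j, s)))
    else .inr (.inr (.inl (l, !s)))
  | .inr (.inr (.inr (i, s))) => .inr (.inr (.inr (i, !s)))

/-- Exchange of a block of two vertices with one side of the rungs `j` and `j + 1`. -/
def swapPair (j : Fin 5) (i : Fin m) : Template m r → Template m r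
  | .inl (i', s) => if i' = i then .inr (.inr (.inl (if s then j + 1 else j, false)))
      else .inl (i', s)
  | .inr (.inl z) => .inr (.inl z)
  | .inr (.inr (.inl (l, s))) =>
    if s = false ∧ l = j then .inl (i, false)
    else if s = false ∧ l = j + 1 then .inl (i, true)
    else .inr (.inr (.inl (l, s)))
  | .inr (.inr (.inr z)) => .inr (.inr (.inr z))

/-- Exchange of a block of four vertices with the rungs `j` and `j + 1`. -/
def swapQuad (j : Fin 5) (i : Fin m) : Template m r → Template m r
  | .inl z => .inl z
  | .inr (.inl (i', s, t)) => if i' = i then .inr (.inr (.inl (if t then j + 1 else j, s)))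
      else .inr (.inl (i', s, t))
  | .inr (.inr (.inl (l, s))) =>
    if l = j then .inr (.inl (i, s, false))
    else if l = j + 1 then .inr (.inl (i, s, true))
    else .inr (.inr (.inl (l, s)))
  | .inr (.inr (.inr z)) => .inr (.inr (.inr z))

theorem succ_ne (j : Fin 5) : j + 1 ≠ j := by revert j; decide

theorem mate_involutive (j : Fin 5) (y : Option (Fin m) → Bool) :
    Function.Involutive (mate j y : Template m r → Template m r) := by
  have := succ_ne j
  rintro (⟨i, s⟩ | ⟨i, s, t⟩ | ⟨l, s⟩ | ⟨i, s⟩)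
  · simp [mate]
  · by_cases h : y (some i) = true <;> simp [mate, h]
  · by_cases h : y none = true
    · simp [mate, h]
    · by_cases h1 : l = j
      · subst h1; simp [mate, h, this]
      · by_cases h2 : l = j + 1
        · subst h2; simp [mate, h, this]
        · simp [mate, h, h1, h2]
  · simp [mate]

theorem mate_ne (j : Fin 5) (y : Option (Fin m) → Bool) (t : Template m r) : mate j y t ≠ t := by
  have := succ_ne j
  rcases t with (⟨i, s⟩ | ⟨i, s, t⟩ | ⟨l, s⟩ | ⟨i, s⟩)
  · simp [mate]
  · by_cases h : y (some i) = true <;> simp [mate, h]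
  · by_cases h : y none = true
    · simp [mate, h]
    · by_cases h1 : l = j
      · subst h1; simp [mate, h, this]
      · by_cases h2 : l = j + 1
        · subst h2; simp [mate, h, this.symm]
        · simp [mate, h, h1, h2]
  · simp [mate]

theorem swapPair_involutive (j : Fin 5) (i : Fin m) :
    Function.Involutive (swapPair j i : Template m r → Template m r) := by
  have := succ_ne j
  rintro (⟨i', s⟩ | ⟨i', s, t⟩ | ⟨l, s⟩ | ⟨i', s⟩)
  · by_cases h : i' = i <;> cases s <;> simp [swapPair, h, this]
  · simp [swapPair]
  · by_cases h1 : l = j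
    · subst h1; cases s <;> simp [swapPair]
    · by_cases h2 : l = j + 1
      · subst h2; cases s <;> simp [swapPair, this]
      · simp [swapPair, h1, h2]
  · simp [swapPair]

theorem swapQuad_involutive (j : Fin 5) (i : Fin m) :
    Function.Involutive (swapQuad j i : Template m r → Template m r) := by
  have := succ_ne j
  rintro (⟨i', s⟩ | ⟨i', s, t⟩ | ⟨l, s⟩ | ⟨i', s⟩)
  · simp [swapQuad]
  · by_cases h : i' = i <;> cases t <;> simp [swapQuad, h, this]
  · by_cases h1 : l = j
    · subst h1; simp [swapQuad]
    · by_cases h2 : l = j + 1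
      · subst h2; simp [swapQuad, this]
      · simp [swapQuad, h1, h2]
  · simp [swapQuad]

theorem cut_swapPair (j : Fin 5) (i : Fin m) (x : Option (Fin m) → Bool) (t : Template m r) :
    cut j x (swapPair j i t) = cut j (x ∘ Equiv.swap none (some i)) t := by
  have := succ_ne j
  rcases t with (⟨i', s⟩ | ⟨i', s, t⟩ | ⟨l, s⟩ | ⟨i', s⟩)
  · by_cases h : i' = i
    · cases s <;> simp [swapPair, cut, h]
    · have : Equiv.swap none (some i) (some i') = some i' :=
        Equiv.swap_apply_of_ne_of_ne (by simp) (by simpa using h)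
      simp [swapPair, cut, h, this]
  · simp [swapPair, cut]
  · by_cases h1 : l = j
    · subst h1; cases s <;> simp [swapPair, cut]
    · by_cases h2 : l = j + 1
      · subst h2; cases s <;> simp [swapPair, cut, this]
      · simp [swapPair, cut, h1, h2]
  · simp [swapPair, cut]

theorem mate_swapPair (j : Fin 5) (i : Fin m) (y : Option (Fin m) → Bool) (hy : y none = false)
    (t : Template m r) : mate j y (swapPair j i t) = swapPair j i (mate j y t) := by
  have := succ_ne j
  rcases t with (⟨i', s⟩ | ⟨i', s, t⟩ | ⟨l, s⟩ | ⟨i', s⟩)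
  · by_cases h : i' = i <;> cases s <;> simp [swapPair, mate, h, hy, this]
  · by_cases h : y (some i') = true <;> simp [swapPair, mate, h]
  · by_cases h1 : l = j
    · subst h1; cases s <;> simp [swapPair, mate, hy, this]
    · by_cases h2 : l = j + 1
      · subst h2; cases s <;> simp [swapPair, mate, hy, this]
      · cases s <;> simp [swapPair, mate, hy, h1, h2]
  · simp [swapPair, mate]

theorem cut_swapQuad (j : Fin 5) (i : Fin m) (x : Option (Fin m) → Bool) (hx : x none = false)
    (t : Template m r) : cut j x (swapQuad j i t) = cut j x t := by
  have := succ_ne j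
  rcases t with (⟨i', s⟩ | ⟨i', s, t⟩ | ⟨l, s⟩ | ⟨i', s⟩)
  · simp [swapQuad, cut]
  · by_cases h : i' = i <;> cases t <;> simp [swapQuad, cut, h, hx]
  · by_cases h1 : l = j
    · subst h1; simp [swapQuad, cut, hx]
    · by_cases h2 : l = j + 1
      · subst h2; simp [swapQuad, cut, hx, this]
      · simp [swapQuad, cut, h1, h2]
  · simp [swapQuad, cut]

theorem mate_swapQuad (j : Fin 5) (i : Fin m) (y : Option (Fin m) → Bool) (t : Template m r) :
    mate j y (swapQuad j i t) = swapQuad j i (mate j (y ∘ Equiv.swap none (some i)) t) := by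
  have := succ_ne j
  rcases t with (⟨i', s⟩ | ⟨i', s, t⟩ | ⟨l, s⟩ | ⟨i', s⟩)
  · simp [swapQuad, mate]
  · by_cases h : i' = i
    · subst h
      by_cases h : y none = true <;> cases t <;> simp [swapQuad, mate, h, this]
    · have h' : Equiv.swap none (some i) (some i') = some i' :=
        Equiv.swap_apply_of_ne_of_ne (by simp) (by simpa using h)
      by_cases h2 : y (some i') = true <;> simp [swapQuad, mate, h, h', h2]
  · by_cases h : y (some i) = true
    · by_cases h1 : l = j
      · subst h1; simp [swapQuad, mate, h]
      · by_cases h2 : l = j + 1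
        · subst h2; simp [swapQuad, mate, h, this]
        · by_cases h3 : y none = true <;> simp [swapQuad, mate, h, h1, h2, h3]
    · by_cases h1 : l = j
      · subst h1; simp [swapQuad, mate, h, this]
      · by_cases h2 : l = j + 1
        · subst h2; simp [swapQuad, mate, h, this]
        · by_cases h3 : y none = true <;> simp [swapQuad, mate, h, h1, h2, h3]
  · simp [swapQuad, mate]

theorem cut_congr (j j' : Fin 5) {x : Option (Fin m) → Bool} (hx : x none = true) :
    (cut j x : Template m r → Bool) = cut j' x := by
  funext t
  rcases t with (⟨i', s⟩ | ⟨i', s, t⟩ | ⟨l, s⟩ | ⟨i', s⟩) <;> simp [cut, hx]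

theorem mate_congr (j j' : Fin 5) {y : Option (Fin m) → Bool} (hy : y none = true) :
    (mate j y : Template m r → Template m r) = mate j' y := by
  funext t
  rcases t with (⟨i', s⟩ | ⟨i', s, t⟩ | ⟨l, s⟩ | ⟨i', s⟩) <;> simp [mate, hy]

/-- The number of matching edges crossing the cut only depends on the ladder. -/
theorem crossing_eq (j j' : Fin 5) (x y : Option (Fin m) → Bool) :
    (∑ t : Template m r, if cut j x t = true ∧ cut j x (mate j' y t) = false then 1 else 0)
      = ∑ l : Fin 5, if (if l = j ∨ l = j + 1 then x none else true) = true ∧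
          (if y none = true then false else
            if l = j' then (if j' + 1 = j ∨ j' + 1 = j + 1 then x none else true)
            else if l = j' + 1 then (if j' = j ∨ j' = j + 1 then x none else true)
            else false) = false then 1 else 0 := by
  rw [Fintype.sum_sum_type, Fintype.sum_sum_type, Fintype.sum_sum_type,
    Fintype.sum_prod_type (f := fun z : Fin 5 × Bool => _)]
  have h1 : ∀ z : Fin m × Bool, (if cut j x (Sum.inl z : Template m r) = true ∧
      cut j x (mate j' y (Sum.inl z : Template m r)) = false then 1 else 0) = 0 := fun z => by
    cases h : x (some z.1) <;> simp [cut, mate, h]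
  have h2 : ∀ z : Fin m × Bool × Bool, (if cut j x (Sum.inr (Sum.inl z) : Template m r) = true ∧
      cut j x (mate j' y (Sum.inr (Sum.inl z) : Template m r)) = false then 1 else 0) = 0 :=
    fun z => by simp [cut]
  have h3 : ∀ z : Fin r × Bool, (if cut j x (Sum.inr (Sum.inr (Sum.inr z)) : Template m r) = true ∧
      cut j x (mate j' y (Sum.inr (Sum.inr (Sum.inr z)) : Template m r)) = false
        then 1 else 0) = 0 :=
    fun z => by simp [cut]
  simp only [h1, h2, h3, Finset.sum_const_zero, zero_add, add_zero]
  refine Finset.sum_congr rfl fun l _ => ?_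
  rw [Fintype.sum_bool]
  by_cases hy : y none = true
  · simp [cut, mate, hy]
  · by_cases h1 : l = j'
    · simp [cut, mate, hy, h1]
    · by_cases h2 : l = j' + 1 <;> simp [cut, mate, hy, h1, h2]

theorem crossing_three (j : Fin 5) {x y : Option (Fin m) → Bool} (hx : x none = false)
    (hy : y none = false) :
    (∑ t : Template m r, if cut j x t = true ∧ cut j x (mate j y t) = false then 1 else 0)
      = 3 := by
  rw [crossing_eq, hx, hy]
  revert j
  decide

theorem crossing_five (j : Fin 5) {x y : Option (Fin m) → Bool} (hx : x none = true)
    (hy : y none = true) :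
    (∑ t : Template m r, if cut j x t = true ∧ cut j x (mate j y t) = false then 1 else 0)
      = 5 := by
  rw [crossing_eq, hx, hy]
  revert j
  decide

theorem crossing_one (j : Fin 5) {x y : Option (Fin m) → Bool} (hx : x none = false)
    (hy : y none = false) :
    (∑ t : Template m r, if cut j x t = true ∧ cut j x (mate (j + 2) y t) = false then 1 else 0)
      = 1 := by
  rw [crossing_eq, hx, hy]
  revert j
  decide

/-- Every cut of the template has odd size. -/
theorem odd_sum_cut (j : Fin 5) (x : Option (Fin m) → Bool) :
    Odd (∑ t : Template m r, if cut j x t = true then 1 else 0) := by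
  rw [Fintype.sum_sum_type, Fintype.sum_sum_type, Fintype.sum_sum_type,
    Fintype.sum_prod_type (f := fun z : Fin m × Bool => _),
    Fintype.sum_prod_type (f := fun z : Fin 5 × Bool => _)]
  simp only [cut, Fintype.sum_bool, Bool.not_true, Bool.false_and, Bool.not_false, Bool.true_and,
    Bool.false_eq_true, if_false, Finset.sum_const_zero, zero_add, add_zero]
  refine Even.add_odd ?_ ?_
  · rw [Finset.sum_add_distrib]
    exact Even.add_self _
  cases x none <;> revert j <;> decide

theorem card_eq (m r : ℕ) : Fintype.card (Template m r) = 6 * m + 10 + 2 * r := by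
  simp [Template]
  ring

end Template

theorem subcubeSum_comp_swap {D : Type*} [Fintype D] [DecidableEq D] (φ : (D → Bool) → ℝ)
    (d o : D) (b : Bool) :
    subcubeSum (fun x => φ (x ∘ Equiv.swap d o)) d b = subcubeSum φ o b := by
  unfold subcubeSum
  rw [← Equiv.sum_comp ((Equiv.swap d o).arrowCongr (Equiv.refl Bool))]
  refine Finset.sum_congr rfl fun x _ => ?_
  have h1 : ((Equiv.swap d o).arrowCongr (Equiv.refl Bool)) x = x ∘ Equiv.swap d o := by
    funext i; simp [Equiv.arrowCongr]
  have h2 : (x ∘ Equiv.swap d o) ∘ Equiv.swap d o = x := by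
    funext i; simp
  rw [h1]
  change (if (x ∘ Equiv.swap d o) d = b then φ ((x ∘ Equiv.swap d o) ∘ Equiv.swap d o) else 0) = _
  rw [h2]
  simp

namespace Template

variable {m r : ℕ} {V : Type*}

/-- The cut of the template transported to the vertex set `V`. -/
def cutOn (σ : Template m r ≃ V) (j : Fin 5) (x : Option (Fin m) → Bool) : V → Bool :=
  fun v => cut j x (σ.symm v)

/-- The matching of the template transported to the vertex set `V`. -/
def mateOn (σ : Template m r ≃ V) (j : Fin 5) (y : Option (Fin m) → Bool) : V → V :=
  fun v => σ (mate j y (σ.symm v))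

/-- The symmetry exchanging the distinguished coordinate with `o` in the cuts. -/
def cutSymm (j : Fin 5) : Option (Fin m) → Equiv.Perm (Template m r)
  | none => Equiv.refl _
  | some i => (swapPair_involutive j i).toPerm

/-- The symmetry exchanging the distinguished coordinate with `o` in the matchings. -/
def mateSymm (j : Fin 5) : Option (Fin m) → Equiv.Perm (Template m r)
  | none => Equiv.refl _
  | some i => (swapQuad_involutive j i).toPerm

/-- Relabelling of the template by a permutation. -/
def relabel (τ : Equiv.Perm (Template m r)) : Equiv.Perm (Template m r ≃ V) :=
  Equiv.equivCongr τ (Equiv.refl V)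

theorem relabel_apply (τ : Equiv.Perm (Template m r)) (σ : Template m r ≃ V) (t : Template m r) :
    relabel τ σ t = σ (τ.symm t) := rfl

theorem relabel_symm_apply (τ : Equiv.Perm (Template m r)) (σ : Template m r ≃ V) (v : V) :
    (relabel τ σ).symm v = τ (σ.symm v) := rfl

theorem cutOn_relabel_cutSymm (σ : Template m r ≃ V) (j : Fin 5) (o : Option (Fin m))
    (x : Option (Fin m) → Bool) :
    cutOn (relabel (cutSymm j o) σ) j x = cutOn σ j (x ∘ Equiv.swap none o) := by
  funext v
  rw [cutOn, cutOn, relabel_symm_apply]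
  cases o with
  | none => simp [cutSymm]
  | some i => exact cut_swapPair j i x _

theorem mateOn_relabel_cutSymm (σ : Template m r ≃ V) (j : Fin 5) (o : Option (Fin m))
    {y : Option (Fin m) → Bool} (hy : y none = false) :
    mateOn (relabel (cutSymm j o) σ) j y = mateOn σ j y := by
  funext v
  rw [mateOn, mateOn, relabel_symm_apply, relabel_apply]
  cases o with
  | none => simp [cutSymm]
  | some i =>
    have h : mate j y (cutSymm j (some i) (σ.symm v)) = cutSymm j (some i) (mate j y (σ.symm v)) :=
      mate_swapPair j i y hy _
    rw [h, Equiv.symm_apply_apply]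

theorem cutOn_relabel_mateSymm (σ : Template m r ≃ V) (j : Fin 5) (o : Option (Fin m))
    {x : Option (Fin m) → Bool} (hx : x none = false) :
    cutOn (relabel (mateSymm j o) σ) j x = cutOn σ j x := by
  funext v
  rw [cutOn, cutOn, relabel_symm_apply]
  cases o with
  | none => simp [mateSymm]
  | some i => exact cut_swapQuad j i x hx _

theorem mateOn_relabel_mateSymm (σ : Template m r ≃ V) (j : Fin 5) (o : Option (Fin m))
    (y : Option (Fin m) → Bool) :
    mateOn (relabel (mateSymm j o) σ) j y = mateOn σ j (y ∘ Equiv.swap none o) := by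
  funext v
  rw [mateOn, mateOn, relabel_symm_apply, relabel_apply]
  cases o with
  | none => simp [mateSymm]
  | some i =>
    have h : mate j y (mateSymm j (some i) (σ.symm v))
        = mateSymm j (some i) (mate j (y ∘ Equiv.swap none (some i)) (σ.symm v)) :=
      mate_swapQuad j i y _
    rw [h, Equiv.symm_apply_apply]

/-- The mass which `f` gives to the cuts with prescribed distinguished bit. -/
def cutMass (f : (V → Bool) → ℝ) (σ : Template m r ≃ V) (j : Fin 5) (b : Bool) : ℝ :=
  subcubeSum (fun x => f (cutOn σ j x)) none b

/-- The mass which `g` gives to the matchings with prescribed distinguished bit. -/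
def mateMass (g : (V → V) → ℝ) (σ : Template m r ≃ V) (j : Fin 5) (b : Bool) : ℝ :=
  subcubeSum (fun y => g (mateOn σ j y)) none b

theorem subcubeSum_congr {D : Type*} [Fintype D] [DecidableEq D] {φ ψ : (D → Bool) → ℝ} {i : D}
    {b : Bool} (h : ∀ x, x i = b → φ x = ψ x) : subcubeSum φ i b = subcubeSum ψ i b :=
  Finset.sum_congr rfl fun x _ => by
    split_ifs with hx
    exacts [h x hx, rfl]

theorem cutMass_true (f : (V → Bool) → ℝ) (σ : Template m r ≃ V) (j : Fin 5) :
    cutMass f σ j true = cutMass f σ 0 true :=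
  subcubeSum_congr fun x hx => by unfold cutOn; rw [cut_congr j 0 hx]

theorem mateMass_true (g : (V → V) → ℝ) (σ : Template m r ≃ V) (j : Fin 5) :
    mateMass g σ j true = mateMass g σ 0 true :=
  subcubeSum_congr fun x hx => by unfold mateOn; rw [mate_congr j 0 hx]

variable [Fintype V] [DecidableEq V]

/-- The key inequality between the masses of a combinatorial rectangle on the pairs with three,
five and one crossing edges. -/
theorem rectangle_inequality (f : (V → Bool) → ℝ) (g : (V → V) → ℝ) {F G : ℝ}
    (hf0 : ∀ U, 0 ≤ f U) (hf : ∀ U, f U ≤ F) (hg0 : ∀ M, 0 ≤ g M) (hg : ∀ M, g M ≤ G) :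
    19 / 20 * ∑ σ : Template m r ≃ V, ∑ j, cutMass f σ j false * mateMass g σ j false
      ≤ 13 / 6 * ∑ σ : Template m r ≃ V, cutMass f σ 0 true * mateMass g σ 0 true
        + 6 * ∑ σ : Template m r ≃ V, ∑ j, cutMass f σ j false * mateMass g σ (j + 2) false
        + 10 * (Fintype.card (Template m r ≃ V) * (F * G * (2 ^ (m + 1)) ^ 2 *
            Real.exp (-(((m + 1 : ℕ) : ℝ) / 800000)))) := by
  classical
  have hcard : Fintype.card (Option (Fin m)) = m + 1 := by simp
  have hu0 : ∀ (σ : Template m r ≃ V) j b, 0 ≤ cutMass f σ j b := fun σ j b =>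
    subcubeSum_nonneg (fun _ => hf0 _) _ _
  have hv0 : ∀ (σ : Template m r ≃ V) j b, 0 ≤ mateMass g σ j b := fun σ j b =>
    subcubeSum_nonneg (fun _ => hg0 _) _ _
  have hu : ∀ (σ : Template m r ≃ V) j b, cutMass f σ j b ≤ F * 2 ^ (m + 1) := fun σ j b => by
    rw [← hcard]
    exact (subcubeSum_le (fun _ => hf0 _) _ _).trans (sum_cube_le fun _ => hf _)
  have hv : ∀ (σ : Template m r ≃ V) j b, mateMass g σ j b ≤ G * 2 ^ (m + 1) := fun σ j b => by
    rw [← hcard]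
    exact (subcubeSum_le (fun _ => hg0 _) _ _).trans (sum_cube_le fun _ => hg _)
  have hF0 : 0 ≤ F := (hf0 fun _ => false).trans (hf _)
  have hG0 : 0 ≤ G := (hg0 id).trans (hg _)
  set κ : ℝ := Real.exp (-(((m + 1 : ℕ) : ℝ) / 800000)) with hκ
  have hU : ∀ j : Fin 5, ∑ σ : Template m r ≃ V,
      (if IsBalanced (cutMass f σ j false) (cutMass f σ j true) then 0
        else cutMass f σ j false) * mateMass g σ j false
      ≤ 1 / 40 * ∑ σ : Template m r ≃ V, cutMass f σ j false * mateMass g σ j false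
        + Fintype.card (Template m r ≃ V) * (F * G * (2 ^ (m + 1)) ^ 2 * κ) := fun j => by
    have h := sum_unbalanced_mul_le (none : Option (Fin m)) (fun o => relabel (cutSymm j o))
      (fun (σ : Template m r ≃ V) x => f (cutOn σ j x)) (fun σ => mateMass g σ j false)
      (F := F) (W := G * 2 ^ (m + 1)) (fun _ _ => hf0 _) (fun _ _ => hf _) (fun _ => hv0 _ _ _)
      (fun _ => hv _ _ _) hF0
      (fun o σ => subcubeSum_congr fun y hy => by rw [mateOn_relabel_cutSymm σ j o hy])
      (fun o σ b => by
        rw [← subcubeSum_comp_swap _ none o]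
        exact subcubeSum_congr fun x _ => by rw [cutOn_relabel_cutSymm])
    rw [hcard, ← hκ] at h
    refine h.trans (le_of_eq ?_)
    unfold cutMass
    ring
  have hM : ∀ j : Fin 5, ∑ σ : Template m r ≃ V,
      (if IsBalanced (mateMass g σ j false) (mateMass g σ j true) then 0
        else mateMass g σ j false) * cutMass f σ j false
      ≤ 1 / 40 * ∑ σ : Template m r ≃ V, cutMass f σ j false * mateMass g σ j false
        + Fintype.card (Template m r ≃ V) * (F * G * (2 ^ (m + 1)) ^ 2 * κ) := fun j => by
    have h := sum_unbalanced_mul_le (none : Option (Fin m)) (fun o => relabel (mateSymm j o))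
      (fun (σ : Template m r ≃ V) x => g (mateOn σ j x)) (fun σ => cutMass f σ j false)
      (F := G) (W := F * 2 ^ (m + 1)) (fun _ _ => hg0 _) (fun _ _ => hg _) (fun _ => hu0 _ _ _)
      (fun _ => hu _ _ _) hG0
      (fun o σ => subcubeSum_congr fun y hy => by rw [cutOn_relabel_mateSymm σ j o hy])
      (fun o σ b => by
        rw [← subcubeSum_comp_swap _ none o]
        exact subcubeSum_congr fun x _ => by rw [mateOn_relabel_mateSymm])
    rw [hcard, ← hκ] at h
    refine h.trans (le_of_eq ?_)
    have hcomm : ∑ σ : Template m r ≃ V, cutMass f σ j false * mateMass g σ j false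
        = ∑ σ : Template m r ≃ V, mateMass g σ j false * cutMass f σ j false :=
      Finset.sum_congr rfl fun σ _ => mul_comm _ _
    rw [hcomm]
    unfold mateMass
    ring
  have hpent := Finset.sum_le_sum fun (σ : Template m r ≃ V) (_ : σ ∈ Finset.univ) =>
    pentagon_inequality (fun j => cutMass f σ j false) (fun j => mateMass g σ j false)
      (cutMass f σ 0 true) (mateMass g σ 0 true) (fun _ => hu0 _ _ _) (fun _ => hv0 _ _ _)
      (hu0 _ _ _) (hv0 _ _ _)
  simp only [Finset.sum_add_distrib, ← Finset.mul_sum] at hpent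
  have hUs := Finset.sum_le_sum fun j (_ : j ∈ (Finset.univ : Finset (Fin 5))) => hU j
  have hMs := Finset.sum_le_sum fun j (_ : j ∈ (Finset.univ : Finset (Fin 5))) => hM j
  rw [Finset.sum_comm] at hUs hMs
  simp only [cutMass_true, mateMass_true, Finset.sum_add_distrib, ← Finset.mul_sum,
    Finset.sum_const, Finset.card_univ, Fintype.card_fin, nsmul_eq_mul] at hUs hMs
  rw [Finset.sum_comm (f := fun (j : Fin 5) (σ : Template m r ≃ V) =>
    cutMass f σ j false * mateMass g σ j false)] at hUs hMs
  push_cast at hUs hMs ⊢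
  linarith

end Template

theorem sum_subcubeSum_mul {D R : Type*} [Fintype D] [DecidableEq D] [Fintype R]
    (α β : R → (D → Bool) → ℝ) (i : D) (b b' : Bool) (c : ℝ)
    (h : ∀ x y, x i = b → y i = b' → ∑ k, α k x * β k y = c) :
    ∑ k, subcubeSum (α k) i b * subcubeSum (β k) i b'
      = c * (subcubeSum (fun _ => 1) i b * subcubeSum (fun _ => 1) i b') := by
  unfold subcubeSum
  simp only [Finset.sum_mul_sum]
  rw [Finset.sum_comm, Finset.mul_sum]
  refine Finset.sum_congr rfl fun x _ => ?_
  rw [Finset.sum_comm, Finset.mul_sum]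
  refine Finset.sum_congr rfl fun y _ => ?_
  by_cases hx : x i = b <;> by_cases hy : y i = b' <;> simp [hx, hy]
  exact h x y hx hy

theorem subcubeSum_one (m : ℕ) (b : Bool) :
    subcubeSum (fun _ : Option (Fin m) → Bool => (1 : ℝ)) none b = 2 ^ m := by
  have hneg : subcubeSum (fun _ : Option (Fin m) → Bool => (1 : ℝ)) none false
      = subcubeSum (fun _ : Option (Fin m) → Bool => (1 : ℝ)) none true := by
    unfold subcubeSum
    rw [← Equiv.sum_comp ((Equiv.refl (Option (Fin m))).arrowCongr Equiv.boolNot)]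
    refine Finset.sum_congr rfl fun x _ => ?_
    cases h : x none <;> simp [Equiv.arrowCongr, h]
  have hadd := subcubeSum_add (fun _ : Option (Fin m) → Bool => (1 : ℝ)) none
  have hcard : ∑ _x : Option (Fin m) → Bool, (1 : ℝ) = 2 * 2 ^ m := by
    simp [pow_succ, mul_comm]
  rw [hcard] at hadd
  cases b <;> linarith

/-- The number of edges of the matching `M` leaving the vertex set `U`. -/
def crossing {V : Type*} [Fintype V] (U : V → Bool) (M : V → V) : ℕ :=
  ∑ v, if U v = true ∧ U (M v) = false then 1 else 0

/-- A vertex set of odd size. -/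
def IsOddCut {V : Type*} [Fintype V] (U : V → Bool) : Prop :=
  Odd (∑ v, if U v = true then 1 else 0)

/-- A perfect matching, given as a fixed-point-free involution. -/
def IsPerfectMate {V : Type*} (M : V → V) : Prop :=
  Function.Involutive M ∧ ∀ v, M v ≠ v

namespace Template

variable {m r : ℕ} {V : Type*}

theorem isPerfectMate_mateOn (σ : Template m r ≃ V) (j : Fin 5) (y : Option (Fin m) → Bool) :
    IsPerfectMate (mateOn σ j y) := by
  refine ⟨fun v => ?_, fun v h => ?_⟩
  · simp only [mateOn, Equiv.symm_apply_apply]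
    rw [mate_involutive j y, Equiv.apply_symm_apply]
  · refine mate_ne j y (σ.symm v) ?_
    have h' := congrArg σ.symm h
    rwa [mateOn, Equiv.symm_apply_apply] at h'

variable [Fintype V]

theorem isOddCut_cutOn (σ : Template m r ≃ V) (j : Fin 5) (x : Option (Fin m) → Bool) :
    IsOddCut (cutOn σ j x) := by
  unfold IsOddCut
  rw [← Equiv.sum_comp σ]
  simpa [cutOn] using odd_sum_cut j x

theorem crossing_cutOn_mateOn (σ : Template m r ≃ V) (j j' : Fin 5)
    (x y : Option (Fin m) → Bool) :
    crossing (cutOn σ j x) (mateOn σ j' y)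
      = ∑ t : Template m r, if cut j x t = true ∧ cut j x (mate j' y t) = false then 1 else 0 := by
  unfold crossing
  rw [← Equiv.sum_comp σ]
  simp [cutOn, mateOn]

/-- A nonnegative factorization of the perturbed slack matrix of the odd cut inequalities has
exponentially many terms. -/
theorem one_le_of_factorization [DecidableEq V] {R : Type*} [Fintype R]
    (a : R → (V → Bool) → ℝ) (b : R → (V → V) → ℝ) (F G : R → ℝ) {L ε : ℝ}
    (ha0 : ∀ k U, 0 ≤ a k U) (ha : ∀ k U, a k U ≤ F k) (hb0 : ∀ k M, 0 ≤ b k M)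
    (hb : ∀ k M, b k M ≤ G k) (hFG : ∀ k, F k * G k ≤ L) (hε : ε ≤ 1 / 100)
    (hε0 : 0 ≤ ε)
    (hS : ∀ U M, IsOddCut U → IsPerfectMate M → ∑ k, a k U * b k M = crossing U M - 1 + ε)
    (σ₀ : Template m r ≃ V) :
    1 ≤ 80 * (Fintype.card R * L) * Real.exp (-(((m + 1 : ℕ) : ℝ) / 800000)) := by
  set κ : ℝ := Real.exp (-(((m + 1 : ℕ) : ℝ) / 800000)) with hκ
  set P : ℝ := (Fintype.card (Template m r ≃ V) : ℝ) with hP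
  have hPpos : 0 < P := by
    rw [hP]; exact_mod_cast Fintype.card_pos_iff.mpr ⟨σ₀⟩
  have hrect := Finset.sum_le_sum fun k (_ : k ∈ (Finset.univ : Finset R)) =>
    rectangle_inequality (m := m) (r := r) (a k) (b k) (ha0 k) (ha k) (hb0 k) (hb k)
  have hmass : ∀ (σ : Template m r ≃ V) (j j' : Fin 5) (s s' : Bool) (c : ℝ),
      (∀ x y : Option (Fin m) → Bool, x none = s → y none = s' →
        (crossing (cutOn σ j x) (mateOn σ j' y) : ℝ) = c) →
      ∑ k, cutMass (a k) σ j s * mateMass (b k) σ j' s' = (c - 1 + ε) * (2 ^ m * 2 ^ m) :=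
    fun σ j j' s s' c h => by
      unfold cutMass mateMass
      rw [sum_subcubeSum_mul _ _ none s s' (c - 1 + ε) fun x y hx hy => by
        rw [hS _ _ (isOddCut_cutOn σ j x) (isPerfectMate_mateOn σ j' y), h x y hx hy],
        subcubeSum_one, subcubeSum_one]
  have h3 : ∀ (σ : Template m r ≃ V) j,
      ∑ k, cutMass (a k) σ j false * mateMass (b k) σ j false = (3 - 1 + ε) * (2 ^ m * 2 ^ m) :=
    fun σ j => hmass σ j j _ _ _ fun x y hx hy => by
      rw [crossing_cutOn_mateOn, crossing_three j hx hy]; norm_num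
  have h5 : ∀ (σ : Template m r ≃ V),
      ∑ k, cutMass (a k) σ 0 true * mateMass (b k) σ 0 true = (5 - 1 + ε) * (2 ^ m * 2 ^ m) :=
    fun σ => hmass σ 0 0 _ _ _ fun x y hx hy => by
      rw [crossing_cutOn_mateOn, crossing_five 0 hx hy]; norm_num
  have h1 : ∀ (σ : Template m r ≃ V) j,
      ∑ k, cutMass (a k) σ j false * mateMass (b k) σ (j + 2) false
        = (1 - 1 + ε) * (2 ^ m * 2 ^ m) :=
    fun σ j => hmass σ j (j + 2) _ _ _ fun x y hx hy => by
      rw [crossing_cutOn_mateOn, crossing_one j hx hy]; norm_num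
  have hI3 : ∑ k, ∑ σ : Template m r ≃ V, ∑ j,
      cutMass (a k) σ j false * mateMass (b k) σ j false
        = P * (5 * ((2 + ε) * (2 ^ m * 2 ^ m))) := by
    rw [Finset.sum_comm]
    have : ∀ σ : Template m r ≃ V, ∑ k, ∑ j,
        cutMass (a k) σ j false * mateMass (b k) σ j false
          = 5 * ((2 + ε) * (2 ^ m * 2 ^ m)) := fun σ => by
      rw [Finset.sum_comm, Finset.sum_congr rfl fun j _ => h3 σ j]
      simp only [Finset.sum_const, Finset.card_univ, Fintype.card_fin, nsmul_eq_mul]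
      push_cast
      ring
    simp only [this, Finset.sum_const, Finset.card_univ, nsmul_eq_mul, hP]
  have hI1 : ∑ k, ∑ σ : Template m r ≃ V, ∑ j,
      cutMass (a k) σ j false * mateMass (b k) σ (j + 2) false
        = P * (5 * (ε * (2 ^ m * 2 ^ m))) := by
    rw [Finset.sum_comm]
    have : ∀ σ : Template m r ≃ V, ∑ k, ∑ j,
        cutMass (a k) σ j false * mateMass (b k) σ (j + 2) false
          = 5 * (ε * (2 ^ m * 2 ^ m)) := fun σ => by
      rw [Finset.sum_comm, Finset.sum_congr rfl fun j _ => h1 σ j]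
      simp only [Finset.sum_const, Finset.card_univ, Fintype.card_fin, nsmul_eq_mul]
      push_cast
      ring
    simp only [this, Finset.sum_const, Finset.card_univ, nsmul_eq_mul, hP]
  have hI5 : ∑ k, ∑ σ : Template m r ≃ V,
      cutMass (a k) σ 0 true * mateMass (b k) σ 0 true
        = P * ((4 + ε) * (2 ^ m * 2 ^ m)) := by
    rw [Finset.sum_comm, Finset.sum_congr rfl fun σ _ => h5 σ]
    simp only [Finset.sum_const, Finset.card_univ, nsmul_eq_mul, ← hP]
    ring
  have herr : ∑ k, 10 * (P * (F k * G k * (2 ^ (m + 1)) ^ 2 * κ))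
      ≤ P * (2 ^ m * 2 ^ m) * (40 * (Fintype.card R * L) * κ) := by
    have h : ∀ k ∈ (Finset.univ : Finset R), 10 * (P * (F k * G k * (2 ^ (m + 1)) ^ 2 * κ))
        ≤ P * (2 ^ m * 2 ^ m) * (40 * L * κ) := fun k _ => by
      have hnn : 0 ≤ P * (2 ^ m * 2 ^ m) * 40 * κ := by positivity
      have := mul_le_mul_of_nonneg_left (hFG k) hnn
      have hp : ((2 : ℝ) ^ (m + 1)) ^ 2 = 4 * (2 ^ m * 2 ^ m) := by ring
      rw [hp]
      linarith
    refine (Finset.sum_le_sum h).trans (le_of_eq ?_)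
    simp only [Finset.sum_const, Finset.card_univ, nsmul_eq_mul]
    ring
  simp only [Finset.sum_add_distrib, ← Finset.mul_sum, ← hκ, ← hP] at hrect
  rw [← Finset.mul_sum, ← Finset.mul_sum] at herr
  rw [hI3, hI1, hI5] at hrect
  have hpos : 0 < P * ((2 : ℝ) ^ m * 2 ^ m) := by positivity
  have hfin : P * ((2 : ℝ) ^ m * 2 ^ m) * 1
      ≤ P * (2 ^ m * 2 ^ m) * (80 * (Fintype.card R * L) * κ) := by
    have hεP := mul_le_mul_of_nonneg_left hε hpos.le
    have hεP0 := mul_nonneg hpos.le hε0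
    linarith
  exact le_of_mul_le_mul_left hfin hpos

end Template

/-- Slack matrices of an extended formulation of size at most `m` factor through nonnegative
matrices of inner dimension at most `m + 1`, one factor being constant. -/
theorem exists_slack_factorization {ι A B : Type*} {K : Set (ι → ℝ)} {m : ℕ}
    (hK : ExtensionOfSizeLE K m) (hne : K.Nonempty) (c : A → (ι → ℝ) →ₗ[ℝ] ℝ) (δ : A → ℝ)
    (hc : ∀ a, ∀ x ∈ K, δ a ≤ c a x) (p : B → ι → ℝ) (hp : ∀ b, p b ∈ K) :
    ∃ nh ≤ m, ∃ (u : Fin (nh + 1) → A → ℝ) (v : Fin (nh + 1) → B → ℝ),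
      (∀ k a, 0 ≤ u k a) ∧ (∀ k b, 0 ≤ v k b) ∧ (∀ b, v (Fin.last nh) b = 1) ∧
        ∀ a b, ∑ k, u k a * v k b = c a (p b) - δ a := by
  obtain ⟨l, Q, π, ⟨S, nh, hnh, f, b, rfl⟩, rfl⟩ := hK
  obtain ⟨_, q₀, ⟨hq₀, hfq₀⟩, -⟩ := hne
  have hπ : ∀ q, π q = π.linear q + π 0 := fun q => congrFun π.decomp q
  have hu : ∀ a, ∃ w : Fin (nh + 1) → ℝ, (∀ i, 0 ≤ w i) ∧ ∀ q ∈ S,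
      (c a ∘ₗ π.linear) q - (δ a - c a (π 0))
        = ∑ i : Fin nh, w i.castSucc * (b i - f i q) + w (Fin.last nh) := fun a => by
    refine farkas_affine S f b hq₀ hfq₀ _ _ fun q hq hfq => ?_
    have h := hc a _ ⟨q, ⟨hq, hfq⟩, rfl⟩
    rw [hπ, map_add] at h
    simp only [LinearMap.comp_apply]
    linarith
  choose w hw0 hw using hu
  choose q hq hqp using hp
  refine ⟨nh, hnh, fun k a => w a k,
    fun k y => Fin.lastCases (motive := fun _ => ℝ) 1 (fun i => b i - f i (q y)) k,
    fun k a => hw0 a k, fun k y => ?_, fun y => by simp, fun a y => ?_⟩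
  · refine Fin.lastCases ?_ (fun i => ?_) k
    · simp
    · simpa using (hq y).2 i
  · have h := hw a (q y) (hq y).1
    rw [Fin.sum_univ_castSucc]
    simp only [Fin.lastCases_castSucc, Fin.lastCases_last, mul_one]
    rw [← h, ← hqp y, hπ (q y), map_add, LinearMap.comp_apply]
    ring

/-- The edge `e` has exactly one end in the vertex set `U`. -/
def Crosses {V : Type*} (U : V → Bool) (e : Sym2 V) : Prop :=
  ∃ u w, e = s(u, w) ∧ U u = true ∧ U w = false

section VJoin

variable {n : ℕ}

open Classical in
/-- The total weight of the edges crossing the cut `U`. -/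
noncomputable def cutFunctional (U : Fin n → Bool) : (CompleteEdge n → ℝ) →ₗ[ℝ] ℝ :=
  ∑ e with Crosses U e.val, LinearMap.proj e

open Classical in
theorem cutFunctional_apply (U : Fin n → Bool) (x : CompleteEdge n → ℝ) :
    cutFunctional U x = ∑ e : CompleteEdge n with Crosses U e.val, x e := by
  simp [cutFunctional]

theorem IsVJoin.exists_crosses {F : Set (Sym2 (Fin n))} (hF : IsVJoin n F) {U : Fin n → Bool}
    (hU : IsOddCut U) : ∃ e ∈ F, Crosses U e := by
  classical
  by_contra! hno
  let H : SimpleGraph (Fin n) :=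
    { Adj := fun a b => s(a, b) ∈ F ∧ U a = true ∧ U b = true
      symm := ⟨fun a b h => ⟨Sym2.eq_swap ▸ h.1, h.2.2, h.2.1⟩⟩
      loopless := ⟨fun a h => hF.1 _ h.1 rfl⟩ }
  have hside : ∀ a b, s(a, b) ∈ F → U a = U b := fun a b h => by
    by_contra hne
    cases ha : U a <;> cases hb : U b
    · exact hne (ha.trans hb.symm)
    · exact hno _ h ⟨b, a, Sym2.eq_swap, hb, ha⟩
    · exact hno _ h ⟨a, b, rfl, ha, hb⟩
    · exact hne (ha.trans hb.symm)
  have hodd : ∀ v, Odd (H.degree v) ↔ U v = true := fun v => by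
    cases hv : U v
    · have h0 : H.degree v = 0 := by
        rw [SimpleGraph.degree, Finset.card_eq_zero, Finset.eq_empty_iff_forall_notMem]
        intro w hw
        rw [SimpleGraph.mem_neighborFinset] at hw
        exact Bool.false_ne_true (hv.symm.trans hw.2.1)
      simp [h0]
    · have hinc : H.incidenceSet v = {e ∈ F | v ∈ e} := by
        ext e
        induction e using Sym2.ind with
        | _ a b =>
          constructor
          · rintro ⟨h, hve⟩
            exact ⟨(SimpleGraph.mem_edgeSet H).mp h |>.1, hve⟩
          · rintro ⟨h, hve⟩
            refine ⟨(SimpleGraph.mem_edgeSet H).mpr ?_, hve⟩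
            have hab := hside a b h
            rcases Sym2.mem_iff.mp hve with rfl | rfl
            · exact ⟨h, hv, hab ▸ hv⟩
            · exact ⟨h, hab ▸ hv, hv⟩
      have hdeg := H.card_incidenceSet_eq_degree v
      have h := hF.2 v
      rw [← hinc, ← Nat.card_coe_set_eq, Nat.card_eq_fintype_card, hdeg] at h
      simpa using h
  have heven := H.even_card_odd_degree_vertices
  simp only [hodd] at heven
  rw [IsOddCut, ← Finset.card_filter] at hU
  exact (Nat.not_even_iff_odd.mpr hU) heven

theorem le_of_mem_vjoinDominant {x : CompleteEdge n → ℝ} (hx : x ∈ vjoinDominant n)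
    (c : (CompleteEdge n → ℝ) →ₗ[ℝ] ℝ) {δ : ℝ} (hc : ∀ y, (∀ e, 0 ≤ y e) → 0 ≤ c y)
    (hF : ∀ F, IsVJoin n F → δ ≤ c fun e => Set.indicator F (fun _ => (1 : ℝ)) e.val) :
    δ ≤ c x := by
  obtain ⟨p, hp, y, hy, rfl⟩ := hx
  have hp' : p ∈ {z | δ ≤ c z} := by
    refine convexHull_min ?_ (convex_halfSpace_ge c.isLinear δ) hp
    rintro _ ⟨F, hF', rfl⟩
    exact hF F hF'
  have h := hc y hy
  rw [map_add]
  exact hp'.trans (le_add_of_nonneg_right h)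

theorem nonneg_of_mem_vjoinDominant {x : CompleteEdge n → ℝ} (hx : x ∈ vjoinDominant n)
    (e : CompleteEdge n) : 0 ≤ x e :=
  le_of_mem_vjoinDominant hx (LinearMap.proj e) (fun _ hy => hy e)
    fun _ _ => Set.indicator_nonneg (fun _ _ => zero_le_one) _

theorem one_le_cutFunctional {U : Fin n → Bool} (hU : IsOddCut U) {x : CompleteEdge n → ℝ}
    (hx : x ∈ vjoinDominant n) : 1 ≤ cutFunctional U x := by
  classical
  refine le_of_mem_vjoinDominant hx (cutFunctional U) (fun y hy => ?_) fun F hF => ?_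
  · rw [cutFunctional_apply]
    exact Finset.sum_nonneg fun e _ => hy e
  · obtain ⟨e, heF, he⟩ := hF.exists_crosses hU
    rw [cutFunctional_apply]
    refine le_trans (by simp [heF]) (Finset.single_le_sum
      (f := fun e : CompleteEdge n => Set.indicator F (fun _ => (1 : ℝ)) e.val)
      (fun e _ => Set.indicator_nonneg (fun _ _ => zero_le_one) _)
      (Finset.mem_filter.mpr ⟨Finset.mem_univ (⟨e, hF.1 e heF⟩ : CompleteEdge n), he⟩))

theorem IsVJoin.indicator_mem_vjoinDominant {F : Set (Sym2 (Fin n))} (hF : IsVJoin n F) :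
    (fun e : CompleteEdge n => Set.indicator F (fun _ => (1 : ℝ)) e.val) ∈ vjoinDominant n :=
  ⟨_, subset_convexHull ℝ _ ⟨F, hF, rfl⟩, 0, fun _ => le_rfl, add_zero _⟩

theorem add_single_mem_vjoinDominant {x : CompleteEdge n → ℝ} (hx : x ∈ vjoinDominant n)
    (e : CompleteEdge n) : x + Pi.single e 1 ∈ vjoinDominant n := by
  obtain ⟨p, hp, y, hy, rfl⟩ := hx
  refine ⟨p, hp, y + Pi.single e 1, fun e' => add_nonneg (hy e') ?_, (add_assoc _ _ _).symm⟩
  exact (Pi.single_nonneg.mpr zero_le_one : (0 : CompleteEdge n → ℝ) ≤ Pi.single e 1) e'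

theorem isVJoin_univ (hn : Even n) : IsVJoin n {e | ¬ e.IsDiag} := by
  classical
  refine ⟨fun e he => he, fun v => ?_⟩
  have hinc : (⊤ : SimpleGraph (Fin n)).incidenceSet v
      = {e ∈ {e : Sym2 (Fin n) | ¬ e.IsDiag} | v ∈ e} := by
    ext e
    simp [SimpleGraph.incidenceSet]
  have hpos : 1 ≤ n := v.pos
  rw [← hinc, ← Nat.card_coe_set_eq, Nat.card_eq_fintype_card,
    SimpleGraph.card_incidenceSet_eq_degree, SimpleGraph.complete_graph_degree, Fintype.card_fin]
  exact Nat.Even.sub_odd hpos hn odd_one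

theorem vjoinDominant_nonempty (hn : Even n) : (vjoinDominant n).Nonempty :=
  ⟨_, (isVJoin_univ hn).indicator_mem_vjoinDominant⟩

theorem IsPerfectMate.isVJoin {M : Fin n → Fin n} (hM : IsPerfectMate M) :
    IsVJoin n (Set.range fun v => s(v, M v)) := by
  refine ⟨?_, fun v => ?_⟩
  · rintro _ ⟨v, rfl⟩ h
    exact hM.2 v (Sym2.mk_isDiag_iff.mp h).symm
  · have h : {e ∈ Set.range fun v => s(v, M v) | v ∈ e} = {s(v, M v)} := by
      ext e
      constructor
      · rintro ⟨⟨w, rfl⟩, hv⟩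
        rcases Sym2.mem_iff.mp hv with rfl | rfl
        · rfl
        · simp [hM.1 w, Sym2.eq_swap]
      · rintro rfl
        exact ⟨⟨v, rfl⟩, Sym2.mem_mk_left _ _⟩
    rw [h, Set.ncard_singleton]
    exact odd_one

theorem cutFunctional_mate (U : Fin n → Bool) {M : Fin n → Fin n} (hM : IsPerfectMate M) :
    cutFunctional U (fun e : CompleteEdge n =>
      Set.indicator (Set.range fun v => s(v, M v)) (fun _ => (1 : ℝ)) e.val) = crossing U M := by
  classical
  rw [cutFunctional_apply, crossing, ← Finset.card_filter]
  simp only [Set.indicator_apply]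
  rw [← Finset.sum_filter, Finset.sum_const, nsmul_eq_mul, mul_one, Nat.cast_inj, eq_comm]
  refine Finset.card_bij (fun v _ => ⟨s(v, M v), hM.isVJoin.1 _ ⟨v, rfl⟩⟩) (fun v hv => ?_)
    (fun v hv w hw h => ?_) fun e he => ?_
  · simp only [Finset.mem_filter, Finset.mem_univ, true_and] at hv ⊢
    exact ⟨⟨v, M v, rfl, hv.1, hv.2⟩, ⟨v, rfl⟩⟩
  · simp only [Finset.mem_filter, Finset.mem_univ, true_and] at hv hw
    rcases Sym2.eq_iff.mp (Subtype.ext_iff.mp h) with h | h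
    · exact h.1
    · exact absurd (hv.1.symm.trans (h.1 ▸ hw.2)) Bool.false_ne_true.symm
  · simp only [Finset.mem_filter, Finset.mem_univ, true_and] at he
    obtain ⟨⟨u, w, he', hu, hw⟩, ⟨v, hv⟩⟩ := he
    have hMu : M u = w := by
      rcases Sym2.eq_iff.mp (he'.symm.trans hv.symm) with ⟨rfl, rfl⟩ | ⟨rfl, rfl⟩
      · rfl
      · exact hM.1 _
    refine ⟨u, ?_, ?_⟩
    · simp [hu, hw, hMu]
    · exact Subtype.ext ((congrArg (fun z => s(u, z)) hMu).trans he'.symm)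

theorem crossing_le (U : Fin n → Bool) (M : Fin n → Fin n) : crossing U M ≤ n := by
  classical
  rw [crossing, ← Finset.card_filter]
  exact (Finset.card_le_univ _).trans_eq (Fintype.card_fin n)

variable {K : Set (CompleteEdge n → ℝ)} {t : ℝ}

/-- A polyhedron sandwiched between the dominant and a dilate has extension complexity at
least two, as soon as there are two different edges. -/
theorem two_le_of_extensionOfSizeLE (hn : Even n) (hn2 : 2 < n) (ht : 0 ≤ t)
    (hsub : vjoinDominant n ⊆ K) (hK : K ⊆ t • vjoinDominant n) {m : ℕ}
    (hm : ExtensionOfSizeLE K m) : 2 ≤ m := by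
  obtain ⟨x, hx⟩ := vjoinDominant_nonempty hn
  let e : Bool → CompleteEdge n := fun s =>
    ⟨s(⟨0, by omega⟩, if s then ⟨1, by omega⟩ else ⟨2, hn2⟩), by cases s <;> simp⟩
  have he : ∀ s, e (!s) ≠ e s := fun s => by cases s <;> simp [e]
  obtain ⟨nh, hnh, u, v, -, -, hlast, huv⟩ := exists_slack_factorization hm
    ⟨x, hsub hx⟩
    (fun s : Bool => LinearMap.proj (e s)) (fun _ => 0)
    (fun s y hy => by
      obtain ⟨z, hz, rfl⟩ := hK hy
      exact mul_nonneg ht (nonneg_of_mem_vjoinDominant hz _))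
    (fun o : Option Bool => o.elim x fun s => x + Pi.single (e s) 1)
    (fun o => by
      cases o with
      | none => exact hsub hx
      | some s => exact hsub (add_single_mem_vjoinDominant hx _))
  by_contra! hlt
  have hdiff : ∀ s s' : Bool, ∑ k : Fin nh, u k.castSucc s * (v k.castSucc (some s')
      - v k.castSucc none) = if s = s' then 1 else 0 := fun s s' => by
    have h1 := huv s (some s')
    have h0 := huv s none
    rw [Fin.sum_univ_castSucc, hlast] at h1 h0
    simp only [mul_sub, Finset.sum_sub_distrib]
    have hes : (Pi.single (e s') 1 : CompleteEdge n → ℝ) (e s) = if s = s' then 1 else 0 := by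
      split_ifs with h
      · rw [h, Pi.single_eq_same]
      · rw [Bool.eq_not.mpr h]
        exact Pi.single_eq_of_ne (he s') _
    simp only [Option.elim, LinearMap.proj_apply, Pi.add_apply, hes] at h1 h0
    linarith
  have htt := hdiff true true
  have htf := hdiff true false
  have hff := hdiff false false
  obtain rfl | rfl : nh = 0 ∨ nh = 1 := by omega
  · simp at htt
  · simp only [Finset.univ_unique, Finset.sum_singleton, if_true, if_false,
      Bool.true_eq_false] at htt htf hff
    rcases mul_eq_zero.mp htf with h | h
    · rw [h, zero_mul] at htt
      exact zero_ne_one htt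
    · rw [h, mul_zero] at hff
      exact zero_ne_one hff

theorem not_subset_zero_smul (hn : Even n) (hn1 : 1 < n) (hsub : vjoinDominant n ⊆ K) :
    ¬ K ⊆ (0 : ℝ) • vjoinDominant n := fun hK => by
  obtain ⟨x, hx⟩ := vjoinDominant_nonempty hn
  have hzero : ∀ y ∈ vjoinDominant n, y = 0 := fun y hy => by
    obtain ⟨z, -, rfl⟩ := hK (hsub hy)
    exact zero_smul ℝ z
  let e : CompleteEdge n := ⟨s(⟨0, by omega⟩, ⟨1, hn1⟩), by simp⟩
  have h := hzero _ (add_single_mem_vjoinDominant hx e)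
  rw [hzero x hx, zero_add] at h
  simpa using congrFun h e

theorem one_le_of_extensionOfSizeLE (hn : Even n) (hn10 : 10 ≤ n) {ε : ℝ} (hε0 : 0 ≤ ε)
    (hε : ε ≤ 1 / 100) (hsub : vjoinDominant n ⊆ K) (hK : K ⊆ (1 - ε) • vjoinDominant n) {m : ℕ}
    (hm : ExtensionOfSizeLE K m) :
    1 ≤ 80 * ((m + 1) * n) * Real.exp (-(((n - 10) / 6 + 1 : ℕ) / 800000)) := by
  classical
  obtain ⟨nh, hnh, u, v, hu0, hv0, -, huv⟩ := exists_slack_factorization hm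
    ((vjoinDominant_nonempty hn).mono hsub)
    (fun U : {U : Fin n → Bool // IsOddCut U} => cutFunctional U.1) (fun _ => 1 - ε)
    (fun U y hy => by
      obtain ⟨z, hz, rfl⟩ := hK hy
      have h := one_le_cutFunctional U.2 hz
      simp only [map_smul, smul_eq_mul]
      nlinarith)
    (fun (M : {M : Fin n → Fin n // IsPerfectMate M}) (e : CompleteEdge n) =>
      Set.indicator (Set.range fun v => s(v, M.1 v)) (fun _ => (1 : ℝ)) e.val)
    (fun M => hsub M.2.isVJoin.indicator_mem_vjoinDominant)
  simp only [Subtype.forall] at huv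
  let a : Fin (nh + 1) → (Fin n → Bool) → ℝ := fun k U =>
    if h : IsOddCut U then u k ⟨U, h⟩ else 0
  let b : Fin (nh + 1) → (Fin n → Fin n) → ℝ := fun k M =>
    if h : IsPerfectMate M then v k ⟨M, h⟩ else 0
  have ha0 : ∀ k U, 0 ≤ a k U := fun k U => by
    by_cases h : IsOddCut U <;> simp [a, h, hu0]
  have hb0 : ∀ k M, 0 ≤ b k M := fun k M => by
    by_cases h : IsPerfectMate M <;> simp [b, h, hv0]
  have hab : ∀ U M, IsOddCut U → IsPerfectMate M →
      ∑ k, a k U * b k M = crossing U M - 1 + ε := fun U M hU hM => by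
    have h := huv U hU M hM
    rw [cutFunctional_mate U hM] at h
    simp only [a, b, dif_pos hU, dif_pos hM, h]
    ring
  have : Nonempty (Fin n) := ⟨⟨0, by omega⟩⟩
  choose Um hUm using fun k => Finite.exists_max (a k)
  choose Mm hMm using fun k => Finite.exists_max (b k)
  have hFG : ∀ k, a k (Um k) * b k (Mm k) ≤ n := fun k => by
    by_cases hU : IsOddCut (Um k)
    · by_cases hM : IsPerfectMate (Mm k)
      · refine (Finset.single_le_sum (f := fun i => a i (Um k) * b i (Mm k))
          (fun i _ => mul_nonneg (ha0 i _) (hb0 i _)) (Finset.mem_univ k)).trans ?_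
        rw [hab _ _ hU hM]
        have h : (crossing (Um k) (Mm k) : ℝ) ≤ n := by exact_mod_cast crossing_le _ _
        linarith
      · simp [b, hM]
    · simp [a, hU]
  have hcard : Fintype.card (Template ((n - 10) / 6) ((n - 10) % 6 / 2))
      = Fintype.card (Fin n) := by
    rw [Template.card_eq, Fintype.card_fin]
    obtain ⟨k, rfl⟩ := hn
    omega
  have h := Template.one_le_of_factorization a b (fun k => a k (Um k)) (fun k => b k (Mm k))
    ha0 hUm hb0 hMm hFG hε hε0 hab (Fintype.equivOfCardEq hcard)
  refine h.trans ?_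
  rw [Fintype.card_fin]
  have hnm : ((nh + 1 : ℕ) : ℝ) ≤ m + 1 := by exact_mod_cast Nat.succ_le_succ hnh
  gcongr

theorem two_rpow_lt_of_one_le {m : ℕ} (hn10 : 18 ≤ n)
    (hlarge : 160 * (n : ℝ) < Real.exp (n / 19200000))
    (h : 1 ≤ 80 * ((m + 1 : ℝ) * n) * Real.exp (-(((n - 10) / 6 + 1 : ℕ) / 800000))) :
    (2 : ℝ) ^ ((n : ℝ) / 19200000) < m := by
  set T : ℝ := Real.exp (n / 19200000) with hT
  have hT1 : 1 ≤ T := Real.one_le_exp (by positivity)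
  have hexp : Real.exp (-(((n - 10) / 6 + 1 : ℕ) / 800000)) ≤ (T * T)⁻¹ := by
    rw [hT, ← Real.exp_add, ← Real.exp_neg, Real.exp_le_exp, neg_le_neg_iff]
    have : (n : ℝ) ≤ 12 * ((n - 10) / 6 + 1 : ℕ) := by
      have : n ≤ 12 * ((n - 10) / 6 + 1) := by omega
      exact_mod_cast this
    linarith
  have hTT : T * T ≤ 80 * ((m + 1 : ℝ) * n) := by
    have h2 := h.trans (mul_le_mul_of_nonneg_left hexp (by positivity))
    rwa [← div_eq_mul_inv, one_le_div (by positivity)] at h2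
  have hrpow : (2 : ℝ) ^ ((n : ℝ) / 19200000) ≤ T := by
    rw [hT, ← Real.exp_one_rpow]
    exact Real.rpow_le_rpow zero_le_two (by linarith [Real.add_one_le_exp (1 : ℝ)])
      (by positivity)
  refine hrpow.trans_lt ?_
  by_contra! hmT
  have hn0 : (0 : ℝ) < n := by exact_mod_cast (by omega : 0 < n)
  have h1 : 80 * ((m + 1 : ℝ) * n) ≤ 80 * ((T + T) * n) := by gcongr
  have h2 : 160 * n * T < T * T := mul_lt_mul_of_pos_right hlarge (by linarith)
  linarith

theorem eventually_lt_exp :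
    ∀ᶠ n : ℕ in Filter.atTop, 160 * (n : ℝ) < Real.exp (n / 19200000) := by
  have h := ((Real.tendsto_exp_div_pow_atTop 1).comp
    ((tendsto_natCast_atTop_atTop (R := ℝ)).atTop_div_const
      (by norm_num : (0 : ℝ) < 19200000))).eventually_gt_atTop (160 * 19200000)
  filter_upwards [h, Filter.eventually_gt_atTop 0] with n hn hpos
  have hn0 : (0 : ℝ) < n := by exact_mod_cast hpos
  simp only [Function.comp_apply, pow_one] at hn
  rw [lt_div_iff₀ (by positivity)] at hn
  linarith

end VJoin

/-- There exist constants `α, γ > 0` such that for every even `n > 0`,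
every polyhedron `K` with `P_vjoin↑(n) ⊆ K ⊆ (1 - α/n⁴)·P_vjoin↑(n)` satisfies
`xc(K) > 2^(γ·n)`. -/
theorem vjoin_dominant_xc_lower_bound :
    ∃ α γ : ℝ, 0 < α ∧ 0 < γ ∧
      ∀ n : ℕ, Even n → 0 < n →
        ∀ K : Set (CompleteEdge n → ℝ), IsPolyhedron K →
          vjoinDominant n ⊆ K → K ⊆ (1 - α / (n : ℝ) ^ 4) • vjoinDominant n →
          ∀ m : ℕ, ExtensionOfSizeLE K m → (2 : ℝ) ^ (γ * (n : ℝ)) < (m : ℝ) := by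
  obtain ⟨N, hN⟩ := Filter.eventually_atTop.mp eventually_lt_exp
  refine ⟨16, min (1 / 19200000) (1 / (N + 18)), by norm_num, by positivity,
    fun n hn hpos K _ hsub hK m hm => ?_⟩
  have hn0 : (0 : ℝ) < n := by exact_mod_cast hpos
  obtain rfl | hn2 : n = 2 ∨ 2 < n := by
    obtain ⟨k, rfl⟩ := hn
    omega
  · norm_num at hK
    exact absurd hK (not_subset_zero_smul hn one_lt_two hsub)
  have hn4 : 4 ≤ n := by
    obtain ⟨k, rfl⟩ := hn
    omega
  by_cases hlarge : N + 18 ≤ n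
  · have hε : 16 / (n : ℝ) ^ 4 ≤ 1 / 100 := by
      have h10 : (10 : ℝ) ≤ n := by exact_mod_cast (by omega : 10 ≤ n)
      have hpow : (10 : ℝ) ^ 4 ≤ (n : ℝ) ^ 4 := by gcongr
      rw [div_le_div_iff₀ (by positivity) (by norm_num)]
      linarith
    refine lt_of_le_of_lt (Real.rpow_le_rpow_of_exponent_le one_le_two ?_)
      (two_rpow_lt_of_one_le (by omega) (hN n (by omega))
        (one_le_of_extensionOfSizeLE hn (by omega) (by positivity) hε hsub hK hm))
    exact (mul_le_mul_of_nonneg_right (min_le_left _ _) hn0.le).trans_eq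
      (one_div_mul_eq_div _ _)
  · have hε : 16 / (n : ℝ) ^ 4 ≤ 1 := by
      have h4 : (4 : ℝ) ≤ n := by exact_mod_cast hn4
      have hpow : (4 : ℝ) ^ 4 ≤ (n : ℝ) ^ 4 := by gcongr
      rw [div_le_one (by positivity)]
      linarith
    have h2m : (2 : ℝ) ≤ m := by
      exact_mod_cast two_le_of_extensionOfSizeLE hn hn2 (sub_nonneg.mpr hε) hsub hK hm
    refine lt_of_lt_of_le ?_ h2m
    have hlt : min (1 / 19200000) (1 / ((N : ℝ) + 18)) * n < 1 := by
      have hnN : (n : ℝ) < N + 18 := by exact_mod_cast not_le.mp hlarge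
      calc min (1 / 19200000) (1 / ((N : ℝ) + 18)) * n ≤ 1 / ((N : ℝ) + 18) * n := by
            gcongr
            exact min_le_right _ _
        _ < 1 := by
            rw [one_div_mul_eq_div, div_lt_one (by positivity)]
            exact hnN
    calc (2 : ℝ) ^ (min (1 / 19200000) (1 / ((N : ℝ) + 18)) * n) < 2 ^ (1 : ℝ) :=
          Real.rpow_lt_rpow_of_exponent_lt one_lt_two hlt
      _ = 2 := Real.rpow_one 2
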